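/- Fix an integer d ≥ 1 and non-negative integers (g_k)_{k≥1} with g_k = 0 unless d | k, such that g(z) = Σ_{k≥1} g_k z^k belongs to the class S_d with radius of convergence ρ ∈ (0,1). Let R be the Boltzmann random multiset with independent geometric coordinates. For n divisible by d admitting at least one multiset of total size n, let S_n be a uniformly random multiset of total size n, and define Ŝ_n as follows: if |R| < n and there exists at least one type of size n − |R| (i.e. g_{n−|R|} ≥ 1), choose a type t* uniformly at random among the g_{n−|R|} types of size n − |R| and set Ŝ_n = R + δ_{t*}; otherwise set Ŝ_n equal to a placeholder value ⋄. Then d_TV(S_n, Ŝ_n) → 0 as n → ∞ along multiples of d. -/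

import Mathlib

/-- A power series with coefficient sequence `g`, non-negative coefficients and radius of
convergence `ρ ∈ (0,∞)`, belongs to the class `𝒮_d`. -/
def SubexpClass (d : ℕ) (g : ℕ → ℝ) (ρ : ℝ) : Prop :=
  1 ≤ d ∧ 0 < ρ ∧ (∀ n, 0 ≤ g n) ∧
  (∀ n, ¬ d ∣ n → g n = 0) ∧
  (∃ N, ∀ n, N ≤ n → d ∣ n → 0 < g n) ∧
  Summable (fun n => g n * ρ ^ n) ∧
  (∀ r : ℝ, ρ < r → ¬ Summable (fun n => g n * r ^ n)) ∧
  Filter.Tendsto (fun m => g (d * m) / g (d * m + d)) Filter.atTop (nhds (ρ ^ d)) ∧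
  Filter.Tendsto
    (fun m => (∑ i ∈ Finset.range (d * m + 1), g i * g (d * m - i)) / g (d * m))
    Filter.atTop (nhds (2 * ∑' n, g n * ρ ^ n))


/-- The type of objects ("types"): `g k` distinct objects of each size `k`. -/
abbrev MTy (g : ℕ → ℕ) : Type := Σ k : ℕ, Fin (g k)

/-- The total size of a multiset `m : MTy g →₀ ℕ`: `∑_t m(t) · s(t)`, where the size of the
object `t = ⟨k, i⟩` is `s(t) = k`. -/
def msize (g : ℕ → ℕ) (m : MTy g →₀ ℕ) : ℕ := m.sum fun t c => c * t.1

/-- The point mass at `m` of the uniform distribution on multisets of total size `n`. -/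
noncomputable def pUnif (g : ℕ → ℕ) (n : ℕ) (m : MTy g →₀ ℕ) : ℝ :=
  if msize g m = n then ((Nat.card {m' : MTy g →₀ ℕ // msize g m' = n} : ℝ))⁻¹ else 0

/-- The point mass at `m` of the Boltzmann random multiset `R` with independent geometric
coordinates `ℙ(R(t) = j) = (1 - ρ^{s(t)}) ρ^{j s(t)}`: it equals
`(∏_t (1 - ρ^{s(t)})) · ρ^{|m|}`. -/
noncomputable def pBoltz (g : ℕ → ℕ) (ρ : ℝ) (m : MTy g →₀ ℕ) : ℝ :=
  (∏' t : MTy g, (1 - ρ ^ t.1)) * ρ ^ (msize g m)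

/-- The total variation distance between two probability mass functions on a countable
state space: `sup_E |ℙ(X ∈ E) - ℙ(Y ∈ E)|`. -/
noncomputable def dTV {S : Type*} (p q : S → ℝ) : ℝ :=
  ⨆ E : Set S, |(∑' x : E, p x) - ∑' x : E, q x|

/-- The point mass of `Ŝ_n`: sample the Boltzmann multiset `R`; if `|R| < n` and there is at
least one type of size `n - |R|`, add one element of a uniformly chosen type of size
`n - |R|`; otherwise output the placeholder `⋄` (encoded as `none`). -/
noncomputable def pHat (g : ℕ → ℕ) (ρ : ℝ) (n : ℕ) : Option (MTy g →₀ ℕ) → ℝ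
  | none =>
      ∑' r : MTy g →₀ ℕ,
        if n ≤ msize g r ∨ g (n - msize g r) = 0 then pBoltz g ρ r else 0
  | some m =>
      if msize g m = n then
        ∑' t : MTy g,
          if 1 ≤ m t then pBoltz g ρ (m - Finsupp.single t 1) / (g t.1 : ℝ) else 0
      else 0

open Filter Topology

lemma gc_split (f : ℕ → ℝ) (n K : ℕ) (h : 2 * K ≤ n) :
    ∑ i ∈ Finset.range (n+1), f i = ∑ i ∈ Finset.range K, f i + ∑ i ∈ Finset.Ico K (n+1-K), f i
      + ∑ j ∈ Finset.range K, f (n - j) := by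
  have h1 : ∑ j ∈ Finset.range K, f (n - j) = ∑ i ∈ Finset.Ico (n+1-K) (n+1), f i := by
    have := Finset.sum_Ico_reflect f 0 (show K ≤ n + 1 by omega)
    rw [Finset.range_eq_Ico, this]; simp
  rw [h1, Finset.range_eq_Ico, Finset.range_eq_Ico, Finset.sum_Ico_consecutive _ (by omega) (by omega),
    Finset.sum_Ico_consecutive _ (by omega) (by omega)]

lemma gc_shift (V : ℕ → ℝ) (hVpos : ∀ᶠ n in atTop, 0 < V n)
    (hVr : Tendsto (fun n => V n / V (n+1)) atTop (𝓝 1)) (j : ℕ) :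
    Tendsto (fun n => V (n - j) / V n) atTop (𝓝 1) := by
  rw [← tendsto_add_atTop_iff_nat j]
  simp only [Nat.add_sub_cancel]
  induction j with
  | zero =>
    refine tendsto_const_nhds.congr' ?_
    filter_upwards [hVpos] with n hn
    simp [hn.ne']
  | succ j ih =>
    have h2 : Tendsto (fun n => V (n+j) / V (n+j+1)) atTop (𝓝 1) :=
      hVr.comp (tendsto_add_atTop_nat j)
    have h3 := ih.mul h2
    rw [one_mul] at h3
    refine h3.congr' ?_
    filter_upwards [(tendsto_add_atTop_nat j).eventually hVpos] with n hn
    rw [← add_assoc]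
    field_simp

lemma gc_step (U V B : ℕ → ℝ) (hV0 : ∀ n, 0 ≤ V n) (hVpos : ∀ᶠ n in atTop, 0 < V n)
    (hVs : Summable V) (hVr : Tendsto (fun n => V n / V (n+1)) atTop (𝓝 1))
    (hVc : Tendsto (fun n => (∑ i ∈ Finset.range (n+1), V i * V (n-i)) / V n) atTop
      (𝓝 (2 * ∑' n, V n)))
    (hB0 : ∀ n, 0 ≤ B n) (hBV : Tendsto (fun n => B n / V n) atTop (𝓝 1))
    (hU0 : ∀ n, 0 ≤ U n) (hUs : Summable U)
    (hrec : ∀ n : ℕ, (n:ℝ) * U n = ∑ i ∈ Finset.range (n+1), (i:ℝ) * B i * U (n-i))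
    (ε : ℝ) (hε : 0 < ε) (K0 : ℕ) :
    ∃ K ≥ K0, ∃ n0, ∀ n ≥ n0, ∀ M : ℝ, 0 ≤ M → (∀ j, K ≤ j → j < n → U j ≤ M * V j) →
      U n ≤ (∑' n, U n + ε + ε * M) * V n := by
  have hsh := gc_shift V hVpos hVr
  have hBsh : ∀ j, Tendsto (fun n => B (n - j) / V n) atTop (𝓝 1) := by
    intro j
    have h1 := (hBV.comp (tendsto_sub_atTop_nat j)).mul (hsh j)
    rw [one_mul] at h1
    refine h1.congr' ?_
    filter_upwards [(tendsto_sub_atTop_nat j).eventually hVpos] with n hn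
    simp only [Function.comp]
    field_simp
  have hmid : ∀ K : ℕ, Tendsto (fun n => (∑ i ∈ Finset.Ico K (n+1-K), V i * V (n-i)) / V n) atTop
      (𝓝 (2 * ∑' n, V n - 2 * ∑ i ∈ Finset.range K, V i)) := by
    intro K
    have h1 : Tendsto (fun n => ∑ i ∈ Finset.range K, V i * (V (n-i) / V n)) atTop
        (𝓝 (∑ i ∈ Finset.range K, V i * 1)) :=
      tendsto_finsetSum _ fun i _ => (hsh i).const_mul _
    have h2 := hVc.sub (h1.const_mul 2)
    simp only [mul_one] at h2
    refine h2.congr' ?_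
    filter_upwards [eventually_ge_atTop (2*K)] with n hn
    rw [gc_split _ n K hn]
    have : ∑ j ∈ Finset.range K, V (n - j) * V (n - (n-j)) = ∑ i ∈ Finset.range K, V i * V (n-i) := by
      refine Finset.sum_congr rfl fun i hi => ?_
      have := Finset.mem_range.1 hi
      rw [Nat.sub_sub_self (by omega), mul_comm]
    rw [this]
    have : ∑ i ∈ Finset.range K, V i * (V (n-i) / V n) = (∑ i ∈ Finset.range K, V i * V (n-i)) / V n := by
      rw [Finset.sum_div]; exact Finset.sum_congr rfl fun i _ => by ring
    rw [this]; ring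
  have hVt : Tendsto (fun K => 2 * ∑' n, V n - 2 * ∑ i ∈ Finset.range K, V i) atTop (𝓝 0) := by
    have := (hVs.hasSum.tendsto_sum_nat.const_mul 2).const_sub (2 * ∑' n, V n)
    simpa using this
  have e1 := hVt.eventually (gt_mem_nhds (show (0:ℝ) < ε/4 by positivity))
  obtain ⟨K1, hK1⟩ := eventually_atTop.1 hVpos
  obtain ⟨K2, hK2⟩ := eventually_atTop.1 (hBV.eventually (gt_mem_nhds (show (1:ℝ) < 2 by norm_num)))
  obtain ⟨K, hK, hKe⟩ := (e1.and (eventually_ge_atTop (K0 + K1 + K2 + 1))).exists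
  refine ⟨K, by omega, ?_⟩
  have hB2 : ∀ k ≥ K, B k ≤ 2 * V k := by
    intro k hk
    have h1 := hK2 k (by omega)
    have h2 := hK1 k (by omega)
    rw [div_lt_iff₀ h2] at h1
    exact h1.le
  have T1 : Tendsto (fun n => ∑ j ∈ Finset.range K, (B (n-j) / V n) * U j) atTop
      (𝓝 (∑ j ∈ Finset.range K, 1 * U j)) :=
    tendsto_finsetSum _ fun i _ => (hBsh i).mul_const _
  have T2 : Tendsto (fun n : ℕ => ∑ i ∈ Finset.range K, (i * B i) * (V (n-i) / V n) * (1 / (n:ℝ))) atTop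
      (𝓝 (∑ i ∈ Finset.range K, ((i:ℝ) * B i) * 1 * 0)) :=
    tendsto_finsetSum _ fun i _ => ((hsh i).const_mul _).mul tendsto_one_div_atTop_nhds_zero_nat
  simp only [mul_zero, Finset.sum_const_zero, one_mul] at T1 T2
  have hS : ∑ j ∈ Finset.range K, U j ≤ ∑' n, U n := hUs.sum_le_tsum _ fun i _ => hU0 i
  have E1 := T1.eventually (gt_mem_nhds (show ∑ j ∈ Finset.range K, U j < ∑' n, U n + ε by linarith))
  have E2 := T2.eventually (gt_mem_nhds (show (0:ℝ) < ε/2 by positivity))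
  have E3 := (hmid K).eventually (gt_mem_nhds hK)
  obtain ⟨n0, hn0⟩ := eventually_atTop.1 (E1.and (E2.and (E3.and
    (hVpos.and (eventually_ge_atTop (2*K+1))))))
  refine ⟨n0, fun n hn M hM hind => ?_⟩
  obtain ⟨F1, F2, F3, hp, hnK⟩ := hn0 n hn
  have hnpos : (0:ℝ) < n := by exact_mod_cast (by omega : 0 < n)
  have G1 : ∑ j ∈ Finset.range K, B (n-j) * U j ≤ (∑' n, U n + ε) * V n := by
    have : ∑ j ∈ Finset.range K, (B (n-j) / V n) * U j = (∑ j ∈ Finset.range K, B (n-j) * U j) / V n := by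
      rw [Finset.sum_div]; exact Finset.sum_congr rfl fun i _ => by ring
    rw [this, div_lt_iff₀ hp] at F1
    exact F1.le
  have G2 : ∑ i ∈ Finset.range K, (i * B i) * V (n-i) ≤ ε / 2 * (V n * n) := by
    have : ∑ i ∈ Finset.range K, (i * B i) * (V (n-i) / V n) * (1 / (n:ℝ)) =
      (∑ i ∈ Finset.range K, (i * B i) * V (n-i)) / (V n * n) := by
      rw [Finset.sum_div]; exact Finset.sum_congr rfl fun i _ => by field_simp
    rw [this, div_lt_iff₀ (by positivity)] at F2
    exact F2.le
  rw [div_lt_iff₀ hp] at F3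
  have H := hrec n
  rw [gc_split _ n K (by omega)] at H
  have I1 : ∑ i ∈ Finset.range K, (i:ℝ) * B i * U (n-i) ≤ M * (ε / 2 * (V n * n)) := by
    refine le_trans ?_ (mul_le_mul_of_nonneg_left G2 hM)
    rw [Finset.mul_sum]
    refine Finset.sum_le_sum fun i hi => ?_
    have := Finset.mem_range.1 hi
    rcases Nat.eq_zero_or_pos i with rfl | h0
    · simp
    · have h3 := hind (n-i) (by omega) (by omega)
      calc (i:ℝ) * B i * U (n-i) ≤ i * B i * (M * V (n-i)) := 
            mul_le_mul_of_nonneg_left h3 (mul_nonneg (by positivity) (hB0 i))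
        _ = _ := by ring
  have I2 : ∑ i ∈ Finset.Ico K (n+1-K), (i:ℝ) * B i * U (n-i) ≤ n * (2 * M) * (ε/4 * V n) := by
    refine le_trans ?_ (mul_le_mul_of_nonneg_left F3.le (by positivity))
    rw [Finset.mul_sum]
    refine Finset.sum_le_sum fun i hi => ?_
    have := Finset.mem_Ico.1 hi
    have h3 := hind (n-i) (by omega) (by omega)
    have h4 : (i:ℝ) ≤ n := by exact_mod_cast (by omega : i ≤ n)
    calc (i:ℝ) * B i * U (n-i) ≤ n * (2 * V i) * (M * V (n-i)) := by
            refine mul_le_mul (mul_le_mul h4 (hB2 i this.1) (hB0 i) hnpos.le) h3 (hU0 _) ?_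
            have := hV0 i
            positivity
      _ = _ := by ring
  have I3 : ∑ j ∈ Finset.range K, ((n - j : ℕ):ℝ) * B (n-j) * U (n-(n-j)) ≤ n * ((∑' n, U n + ε) * V n) := by
    refine le_trans ?_ (mul_le_mul_of_nonneg_left G1 hnpos.le)
    rw [Finset.mul_sum]
    refine Finset.sum_le_sum fun i hi => ?_
    have := Finset.mem_range.1 hi
    rw [Nat.sub_sub_self (by omega), mul_assoc]
    refine mul_le_mul_of_nonneg_right ?_ (mul_nonneg (hB0 _) (hU0 _))
    exact_mod_cast Nat.sub_le n i
  have : n * U n ≤ n * ((∑' n, U n + ε + ε * M) * V n) := by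
    rw [H]; linarith
  exact le_of_mul_le_mul_left this hnpos

lemma gc_upper (U V B : ℕ → ℝ) (hV0 : ∀ n, 0 ≤ V n) (hVpos : ∀ᶠ n in atTop, 0 < V n)
    (hVs : Summable V) (hVr : Tendsto (fun n => V n / V (n+1)) atTop (𝓝 1))
    (hVc : Tendsto (fun n => (∑ i ∈ Finset.range (n+1), V i * V (n-i)) / V n) atTop
      (𝓝 (2 * ∑' n, V n)))
    (hB0 : ∀ n, 0 ≤ B n) (hBV : Tendsto (fun n => B n / V n) atTop (𝓝 1))
    (hU0 : ∀ n, 0 ≤ U n) (hUs : Summable U)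
    (hrec : ∀ n : ℕ, (n:ℝ) * U n = ∑ i ∈ Finset.range (n+1), (i:ℝ) * B i * U (n-i))
    (ε : ℝ) (hε : 0 < ε) :
    ∀ᶠ n in atTop, U n ≤ (∑' n, U n + ε) * V n := by
  have step := gc_step U V B hV0 hVpos hVs hVr hVc hB0 hBV hU0 hUs hrec
  have hS : 0 ≤ ∑' n, U n := tsum_nonneg hU0
  obtain ⟨N, hN⟩ := eventually_atTop.1 hVpos
  obtain ⟨K, hK, n0, hn0⟩ := step (1/2) (by norm_num) N
  set S := ∑' n, U n
  have hbd : ∃ M : ℝ, 0 ≤ M ∧ ∀ j, K ≤ j → U j ≤ M * V j := by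
    refine ⟨2 * (S + 1) + ∑ i ∈ Finset.range n0, U i / V i, ?_, ?_⟩
    · have : 0 ≤ ∑ i ∈ Finset.range n0, U i / V i := Finset.sum_nonneg fun i _ => div_nonneg (hU0 i) (hV0 i)
      positivity
    intro j
    have h0 : 0 ≤ ∑ i ∈ Finset.range n0, U i / V i := Finset.sum_nonneg fun i _ => div_nonneg (hU0 i) (hV0 i)
    induction j using Nat.strong_induction_on with
    | _ j ih =>
      intro hj
      have hp := hN j (by omega)
      by_cases hjn : j < n0
      · have h1 : U j / V j ≤ ∑ i ∈ Finset.range n0, U i / V i :=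
          Finset.single_le_sum (f := fun i => U i / V i) (fun i _ => div_nonneg (hU0 i) (hV0 i)) (Finset.mem_range.2 hjn)
        rw [← div_le_iff₀ hp]
        linarith
      · refine (hn0 j (by omega) (2 * (S + 1) + ∑ i ∈ Finset.range n0, U i / V i) (by positivity) (fun i h1 h2 => ih i h2 h1)).trans ?_
        refine mul_le_mul_of_nonneg_right ?_ hp.le
        linarith
  obtain ⟨M, hM, hMb⟩ := hbd
  obtain ⟨K', hK', n1, hn1⟩ := step (ε/(1+M)) (by positivity) K
  filter_upwards [eventually_ge_atTop n1] with n hn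
  have := hn1 n hn M hM fun j h1 _ => hMb j (by omega)
  have e : S + ε = S + ε/(1+M) + ε/(1+M) * M := by field_simp; ring
  rwa [e]

lemma gc_hasSum {ι : Type*} (x : ι → ℝ) (h0 : ∀ t, 0 ≤ x t) (h1 : ∀ t, x t < 1) (hs : Summable x) :
    0 < ∏' t, (1 - x t) ∧
    HasSum (fun m : ι →₀ ℕ => m.prod fun t c => x t ^ c) (∏' t, (1 - x t))⁻¹ := by
  classical
  have hm1 : Multipliable (fun t => 1 - x t) := by
    have := Real.multipliable_one_add_of_summable (f := fun t => - x t) hs.neg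
    simpa [sub_eq_add_neg] using this
  have hs2 : Summable (fun t => x t / (1 - x t)) := by
    refine Summable.of_norm_bounded_eventually (g := fun t => 2 * x t) (hs.mul_left 2) ?_
    have := hs.tendsto_cofinite_zero.eventually (gt_mem_nhds (show (0:ℝ) < 1/2 by norm_num))
    filter_upwards [this] with t ht
    have := h0 t
    rw [Real.norm_of_nonneg (div_nonneg this (by linarith)), div_le_iff₀ (by linarith)]
    nlinarith
  have hm2 : Multipliable (fun t => (1 - x t)⁻¹) := by
    have := Real.multipliable_one_add_of_summable hs2
    refine this.congr fun t => ?_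
    have := h1 t
    have : 1 - x t ≠ 0 := by linarith
    field_simp; ring
  have hmul : (∏' t, (1 - x t)) * (∏' t, (1 - x t)⁻¹) = 1 := by
    rw [← hm1.tprod_mul hm2]
    have : ∀ t, (1 - x t) * (1 - x t)⁻¹ = 1 := fun t => mul_inv_cancel₀ (by linarith [h1 t])
    simp [this]
  have hy1 : ∀ t, 1 ≤ (1 - x t)⁻¹ := fun t => by
    rw [one_le_inv₀ (by linarith [h1 t])]; linarith [h0 t]
  have hle : ∀ T : Finset ι, ∏ t ∈ T, (1 - x t)⁻¹ ≤ ∏' t, (1 - x t)⁻¹ := by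
    intro T
    refine ge_of_tendsto hm2.hasProd ?_
    filter_upwards [eventually_ge_atTop T] with T' hT'
    rw [← Finset.prod_sdiff hT']
    have h3 : 1 ≤ ∏ t ∈ T' \ T, (1 - x t)⁻¹ := by
      have := Finset.prod_le_prod (s := T' \ T) (f := fun _ => (1:ℝ)) (fun _ _ => zero_le_one) (fun t _ => hy1 t)
      simpa using this
    exact le_mul_of_one_le_left (Finset.prod_nonneg fun t _ => zero_le_one.trans (hy1 t)) h3
  have hFpos : 0 < ∏' t, (1 - x t)⁻¹ := by
    have := hle ∅
    simp at this; linarith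
  have hinv : (∏' t, (1 - x t))⁻¹ = ∏' t, (1 - x t)⁻¹ := by
    exact inv_eq_of_mul_eq_one_right hmul
  refine ⟨?_, ?_⟩
  · by_contra h
    have := mul_nonpos_of_nonpos_of_nonneg (not_lt.1 h) hFpos.le
    linarith
  rw [hinv]
  have hfin : ∀ (T : Finset ι) (N : ℕ), ∑ m ∈ T.finsupp (fun _ => Finset.range N), (m.prod fun t c => x t ^ c)
      = ∏ t ∈ T, ∑ j ∈ Finset.range N, x t ^ j := by
    intro T N
    rw [Finset.prod_sum, Finset.finsupp, Finset.sum_map]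
    refine Finset.sum_congr (by congr!) fun p hp => ?_
    simp only [Function.Embedding.coeFn_mk]
    rw [Finsupp.prod_of_support_subset _ (Finsupp.support_indicator_subset _ _) _ (by simp),
      ← Finset.prod_attach]
    refine Finset.prod_congr rfl fun t _ => ?_
    rw [Finsupp.indicator_of_mem t.2]
  refine hasSum_of_isLUB_of_nonneg _ (fun m => Finset.prod_nonneg fun t _ => pow_nonneg (h0 t) _) ⟨?_, ?_⟩
  · rintro _ ⟨A, rfl⟩
    set T := A.biUnion (fun m => m.support)
    set N := (∑ m ∈ A, ∑ t ∈ m.support, m t) + 1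
    have hsub : A ⊆ T.finsupp (fun _ => Finset.range N) := by
      intro m hm
      rw [Finset.mem_finsupp_iff]
      refine ⟨Finset.subset_biUnion_of_mem (fun m : ι →₀ ℕ => m.support) hm, fun t _ => ?_⟩
      rw [Finset.mem_range, Nat.lt_succ_iff]
      have h2 : ∑ t ∈ m.support, m t ≤ ∑ m ∈ A, ∑ t ∈ m.support, m t :=
        Finset.single_le_sum (f := fun m : ι →₀ ℕ => ∑ t ∈ m.support, m t) (fun _ _ => Nat.zero_le _) hm
      by_cases ht : t ∈ m.support
      · exact (Finset.single_le_sum (f := fun t => m t) (fun _ _ => Nat.zero_le _) ht).trans h2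
      · rw [Finsupp.notMem_support_iff.1 ht]; exact Nat.zero_le _
    refine (Finset.sum_le_sum_of_subset_of_nonneg hsub 
      (fun m _ _ => Finset.prod_nonneg fun t _ => pow_nonneg (h0 t) _)).trans ?_
    refine (hfin T N).le.trans ?_
    refine le_trans (Finset.prod_le_prod (fun t _ => Finset.sum_nonneg fun j _ => pow_nonneg (h0 t) _) fun t _ => ?_) (hle T)
    rw [← tsum_geometric_of_lt_one (h0 t) (h1 t)]
    exact (summable_geometric_of_lt_one (h0 t) (h1 t)).sum_le_tsum _ fun j _ => pow_nonneg (h0 t) _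
  · intro b hb
    refine le_of_tendsto hm2.hasProd (Eventually.of_forall fun T => ?_)
    have : Tendsto (fun N => ∏ t ∈ T, ∑ j ∈ Finset.range N, x t ^ j) atTop (𝓝 (∏ t ∈ T, (1 - x t)⁻¹)) :=
      tendsto_finsetProd _ fun t _ => (hasSum_geometric_of_lt_one (h0 t) (h1 t)).tendsto_sum_nat
    refine le_of_tendsto this (Eventually.of_forall fun N => ?_)
    rw [← hfin]
    exact hb ⟨_, rfl⟩

lemma gc_msize_add (g : ℕ → ℕ) (r : MTy g →₀ ℕ) (t : MTy g) (j : ℕ) :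
    msize g (r + Finsupp.single t j) = msize g r + j * t.1 := by
  unfold msize
  rw [Finsupp.sum_add_index' (by simp) (by intros; ring), Finsupp.sum_single_index (by simp)]

lemma gc_sub_add (g : ℕ → ℕ) (m : MTy g →₀ ℕ) (t : MTy g) (j : ℕ) (h : j ≤ m t) :
    m - Finsupp.single t j + Finsupp.single t j = m :=
  tsub_add_cancel_of_le (Finsupp.single_le_iff.2 h)

lemma gc_mul_le (g : ℕ → ℕ) (m : MTy g →₀ ℕ) (t : MTy g) : m t * t.1 ≤ msize g m := by
  have := gc_msize_add g (m - Finsupp.single t (m t)) t (m t)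
  rw [gc_sub_add _ _ _ _ le_rfl] at this
  omega

lemma gc_pos (g : ℕ → ℕ) (hg0 : g 0 = 0) (t : MTy g) : 1 ≤ t.1 := by
  obtain ⟨k, i⟩ := t
  rcases Nat.eq_zero_or_pos k with rfl | h
  · exact absurd i.2 (by omega)
  · exact h

/-- types of size at most n -/
def gcT (g : ℕ → ℕ) (n : ℕ) : Finset (MTy g) := (Finset.range (n+1)).sigma fun _ => Finset.univ

lemma gc_memT (g : ℕ → ℕ) (n : ℕ) (t : MTy g) : t ∈ gcT g n ↔ t.1 ≤ n := by
  simp [gcT]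

lemma gc_val_le (g : ℕ → ℕ) (hg0 : g 0 = 0) (m : MTy g →₀ ℕ) (t : MTy g) : m t ≤ msize g m := by
  have := gc_mul_le g m t
  have := gc_pos g hg0 t
  nlinarith

lemma gc_supp (g : ℕ → ℕ) (m : MTy g →₀ ℕ) (t : MTy g) (h : 1 ≤ m t) : t.1 ≤ msize g m := by
  have := gc_mul_le g m t
  nlinarith

lemma gc_finite (g : ℕ → ℕ) (hg0 : g 0 = 0) (n : ℕ) : {m : MTy g →₀ ℕ | msize g m = n}.Finite := by
  refine ((gcT g n).finsupp fun _ => Finset.range (n+1)).finite_toSet.subset ?_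
  rintro m rfl
  rw [Finset.mem_coe, Finset.mem_finsupp_iff]
  refine ⟨fun t ht => ?_, fun t _ => ?_⟩
  · rw [gc_memT]
    refine gc_supp g m t ?_
    have := Finsupp.mem_support_iff.1 ht
    omega
  · rw [Finset.mem_range]
    have := gc_val_le g hg0 m t
    omega

/-- multisets of size n -/
noncomputable def gcA (g : ℕ → ℕ) (hg0 : g 0 = 0) (n : ℕ) : Finset (MTy g →₀ ℕ) := (gc_finite g hg0 n).toFinset

lemma gc_memA (g : ℕ → ℕ) (hg0 : g 0 = 0) (n : ℕ) (m : MTy g →₀ ℕ) : m ∈ gcA g hg0 n ↔ msize g m = n := by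
  simp [gcA]

noncomputable def gca (g : ℕ → ℕ) (n : ℕ) : ℕ := Nat.card {m' : MTy g →₀ ℕ // msize g m' = n}

lemma gc_cardA (g : ℕ → ℕ) (hg0 : g 0 = 0) (n : ℕ) : (gcA g hg0 n).card = gca g n := by
  unfold gca gcA
  exact (Nat.card_eq_card_finite_toFinset (gc_finite g hg0 n)).symm

lemma gc_card_ge (g : ℕ → ℕ) (hg0 : g 0 = 0) (n : ℕ) (t : MTy g) (j : ℕ) :
    ((gcA g hg0 n).filter fun m => j ≤ m t).card = if j * t.1 ≤ n then gca g (n - j * t.1) else 0 := by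
  split_ifs with h
  · rw [← gc_cardA g hg0]
    refine Finset.card_nbij' (fun m => m - Finsupp.single t j) (fun r => r + Finsupp.single t j) ?_ ?_ ?_ ?_
    · intro m hm
      simp only [Finset.coe_filter, Set.mem_ofPred_eq, Finset.mem_coe, gc_memA] at hm ⊢
      have := gc_msize_add g (m - Finsupp.single t j) t j
      rw [gc_sub_add _ _ _ _ hm.2] at this
      omega
    · intro r hr
      simp only [Finset.coe_filter, Set.mem_ofPred_eq, Finset.mem_coe, gc_memA] at hr ⊢
      rw [gc_msize_add]
      simp; omega
    · intro m hm
      simp only [Finset.coe_filter, Set.mem_ofPred_eq] at hm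
      exact gc_sub_add _ _ _ _ hm.2
    · intro r hr
      simp
  · rw [Finset.card_eq_zero, Finset.filter_eq_empty_iff]
    intro m hm hj
    rw [gc_memA] at hm
    have := gc_mul_le g m t
    have : j * t.1 ≤ m t * t.1 := Nat.mul_le_mul_right _ hj
    omega

def gcc (g : ℕ → ℕ) (l : ℕ) : ℕ := ∑ k ∈ l.divisors, k * g k

lemma gc_sumT (g : ℕ → ℕ) (n : ℕ) (f : ℕ → ℝ) : ∑ t ∈ gcT g n, f t.1 = ∑ k ∈ Finset.range (n+1), g k * f k := by
  rw [gcT, Finset.sum_sigma]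
  simp

lemma gc_sumTn (g : ℕ → ℕ) (n : ℕ) (f : ℕ → ℕ) : ∑ t ∈ gcT g n, f t.1 = ∑ k ∈ Finset.range (n+1), g k * f k := by
  rw [gcT, Finset.sum_sigma]
  simp

lemma gc_rec (g : ℕ → ℕ) (hg0 : g 0 = 0) (n : ℕ) :
    n * gca g n = ∑ l ∈ Finset.range (n+1), gcc g l * gca g (n - l) := by
  have h1 : ∑ m ∈ gcA g hg0 n, msize g m = n * gca g n := by
    rw [Finset.sum_congr rfl (fun m hm => (gc_memA g hg0 n m).1 hm), Finset.sum_const, gc_cardA, smul_eq_mul, mul_comm]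
  have h2 : ∀ m ∈ gcA g hg0 n, msize g m = ∑ t ∈ gcT g n, ∑ j ∈ Finset.Icc 1 n, if j ≤ m t then t.1 else 0 := by
    intro m hm
    rw [gc_memA] at hm
    have hsup : m.support ⊆ gcT g n := fun t ht => by
      rw [gc_memT, ← hm]
      refine gc_supp g m t ?_
      have := Finsupp.mem_support_iff.1 ht
      omega
    unfold msize
    rw [Finsupp.sum_of_support_subset _ hsup _ (by simp)]
    refine Finset.sum_congr rfl fun t _ => ?_
    rw [← Finset.sum_filter, Finset.sum_const, smul_eq_mul]
    congr 1
    have : (Finset.Icc 1 n).filter (fun j => j ≤ m t) = Finset.Icc 1 (m t) := by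
      ext j
      have := gc_val_le g hg0 m t
      simp; omega
    rw [this]; simp
  rw [← h1, Finset.sum_congr rfl h2, Finset.sum_comm]
  have h3 : ∀ t ∈ gcT g n, (∑ m ∈ gcA g hg0 n, ∑ j ∈ Finset.Icc 1 n, if j ≤ m t then t.1 else 0)
      = ∑ j ∈ Finset.Icc 1 n, t.1 * (if j * t.1 ≤ n then gca g (n - j * t.1) else 0) := by
    intro t _
    rw [Finset.sum_comm]
    refine Finset.sum_congr rfl fun j _ => ?_
    rw [← Finset.sum_filter, Finset.sum_const, gc_card_ge, smul_eq_mul, mul_comm]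
  rw [Finset.sum_congr rfl h3, gc_sumTn g n (fun k => ∑ j ∈ Finset.Icc 1 n, k * (if j * k ≤ n then gca g (n - j * k) else 0))]
  have h4 : ∀ k ∈ Finset.range (n+1), g k * (∑ j ∈ Finset.Icc 1 n, k * (if j * k ≤ n then gca g (n - j * k) else 0))
      = ∑ l ∈ Finset.range (n+1), if k ∈ l.divisors then k * g k * gca g (n-l) else 0 := by
    intro k hk
    rcases Nat.eq_zero_or_pos k with rfl | hk0
    · simp
    rw [Finset.mul_sum]
    simp only [mul_ite, mul_zero]
    rw [← Finset.sum_filter, ← Finset.sum_filter]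
    refine Finset.sum_nbij' (fun j => j * k) (fun l => l / k) ?_ ?_ ?_ ?_ ?_
    · intro j hj
      simp only [Finset.mem_filter, Finset.mem_Icc, Finset.mem_range, Nat.mem_divisors] at hj ⊢
      refine ⟨by omega, Dvd.intro_left j rfl, ?_⟩
      have : 0 < j * k := Nat.mul_pos (by omega) hk0
      omega
    · intro l hl
      simp only [Finset.mem_filter, Finset.mem_Icc, Finset.mem_range, Nat.mem_divisors] at hl ⊢
      obtain ⟨h1, h2, h3⟩ := hl
      rw [Nat.div_mul_cancel h2]
      refine ⟨⟨Nat.div_pos (Nat.le_of_dvd (by omega) h2) hk0, ?_⟩, by omega⟩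
      exact (Nat.div_le_self _ _).trans (by omega)
    · intro j hj
      exact Nat.mul_div_cancel _ hk0
    · intro l hl
      simp only [Finset.mem_filter, Nat.mem_divisors] at hl
      exact Nat.div_mul_cancel hl.2.1
    · intro j hj
      ring
  rw [Finset.sum_congr rfl h4, Finset.sum_comm]
  refine Finset.sum_congr rfl fun l hl => ?_
  have hl' := Finset.mem_range.1 hl
  rw [gcc, Finset.sum_mul, ← Finset.sum_filter]
  refine Finset.sum_congr ?_ fun _ _ => rfl
  ext k
  simp only [Finset.mem_filter, Finset.mem_range, and_iff_right_iff_imp]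
  intro hk
  have := Nat.divisor_le hk
  omega

lemma gc_boltz_eq (g : ℕ → ℕ) (ρ : ℝ) (m : MTy g →₀ ℕ) :
    ρ ^ msize g m = m.prod fun t c => (ρ ^ t.1) ^ c := by
  unfold msize Finsupp.sum Finsupp.prod
  rw [← Finset.prod_pow_eq_pow_sum]
  exact Finset.prod_congr rfl fun t _ => by beta_reduce; rw [← pow_mul, mul_comm]

lemma gc_boltz (g : ℕ → ℕ) (ρ : ℝ) (hg0 : g 0 = 0) (h0 : 0 < ρ) (h1 : ρ < 1)
    (hs : Summable fun n => (g n : ℝ) * ρ ^ n) :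
    0 < ∏' t : MTy g, (1 - ρ ^ t.1) ∧ HasSum (fun m : MTy g →₀ ℕ => ρ ^ msize g m) (∏' t : MTy g, (1 - ρ ^ t.1))⁻¹ := by
  have := gc_hasSum (fun t : MTy g => ρ ^ t.1) (fun t => by positivity)
    (fun t => pow_lt_one₀ h0.le h1 (by have := gc_pos g hg0 t; omega)) ?_
  · simpa only [gc_boltz_eq] using this
  · rw [summable_sigma_of_nonneg (fun t => by positivity)]
    refine ⟨fun k => (hasSum_fintype _).summable, ?_⟩
    simpa using hs

lemma gc_fiber (g : ℕ → ℕ) (hg0 : g 0 = 0) (f : ℕ → ℝ) (X : ℝ)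
    (h : HasSum (fun m : MTy g →₀ ℕ => f (msize g m)) X) : HasSum (fun k => (gca g k : ℝ) * f k) X := by
  have h2 := (Equiv.sigmaFiberEquiv (msize g)).hasSum_iff.2 h
  refine h2.sigma fun k => ?_
  have : Fintype {m : MTy g →₀ ℕ // msize g m = k} := (gc_finite g hg0 k).fintype
  have h3 := hasSum_fintype (fun m : {m : MTy g →₀ ℕ // msize g m = k} => f (msize g m.1))
  have h4 : ∑ m : {m : MTy g →₀ ℕ // msize g m = k}, f (msize g m.1) = gca g k * f k := by
    rw [Finset.sum_congr rfl (fun m _ => by rw [m.2])]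
    simp [gca]
  rw [h4] at h3
  exact h3

lemma gc_dvd (g : ℕ → ℕ) (d : ℕ) (hd : ∀ n, ¬ d ∣ n → g n = 0) (n : ℕ) (hn : ¬ d ∣ n) : gca g n = 0 := by
  unfold gca
  rw [Nat.card_eq_zero]
  left
  refine ⟨fun m => hn ?_⟩
  rw [← m.2]
  refine Finset.dvd_sum fun t _ => Dvd.dvd.mul_left ?_ _
  by_contra h
  have h2 := t.2.2
  have := hd _ h
  omega

lemma gc_sum_mult (d : ℕ) (hd : 1 ≤ d) (f : ℕ → ℝ) (hf : ∀ l, ¬ d ∣ l → f l = 0) (m : ℕ) :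
    ∑ l ∈ Finset.range (d * m + 1), f l = ∑ i ∈ Finset.range (m+1), f (d * i) := by
  rw [← Finset.sum_image (f := f) (g := fun i => d * i) (s := Finset.range (m+1))
    (fun a _ b _ h => Nat.eq_of_mul_eq_mul_left (by omega) h)]
  symm
  refine Finset.sum_subset ?_ ?_
  · intro l hl
    obtain ⟨i, hi, rfl⟩ := Finset.mem_image.1 hl
    have := Finset.mem_range.1 hi
    rw [Finset.mem_range, Nat.lt_succ_iff]
    exact Nat.mul_le_mul_left d (by omega)
  · intro l hl hl2
    refine hf l fun ⟨i, hi⟩ => hl2 ?_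
    subst hi
    refine Finset.mem_image.2 ⟨i, ?_, rfl⟩
    have := Finset.mem_range.1 hl
    rw [Finset.mem_range, Nat.lt_succ_iff]
    exact Nat.le_of_mul_le_mul_left (by omega) (show 0 < d by omega)

open Classical in
lemma gc_good (g : ℕ → ℕ) (hg0 : g 0 = 0) (n K : ℕ) (h : 2 * K < n) :
    ∑ k ∈ Finset.range (K+1), g (n-k) * gca g k ≤
      ((gcA g hg0 n).filter fun m => ∃ t, 1 ≤ m t ∧ n ≤ t.1 + K).card := by
  have h1 : ∑ k ∈ Finset.range (K+1), g (n-k) * gca g k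
      ≤ ∑ t ∈ gcT g n, if n ≤ t.1 + K then gca g (n - t.1) else 0 := by
    rw [gc_sumTn g n (fun k => if n ≤ k + K then gca g (n - k) else 0)]
    rw [← Finset.sum_range_reflect _ (n+1)]
    refine le_trans (le_of_eq ?_) (Finset.sum_le_sum_of_subset (Finset.range_mono (show K + 1 ≤ n + 1 by omega)))
    refine Finset.sum_congr rfl fun k hk => ?_
    have := Finset.mem_range.1 hk
    rw [if_pos (by omega)]
    congr 2 <;> omega
  have h2 : ∀ t ∈ gcT g n, (if n ≤ t.1 + K then gca g (n - t.1) else 0)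
      = ∑ m ∈ gcA g hg0 n, if 1 ≤ m t ∧ n ≤ t.1 + K then 1 else 0 := by
    intro t ht
    rw [gc_memT] at ht
    split_ifs with hK
    · have := gc_card_ge g hg0 n t 1
      rw [one_mul, if_pos ht] at this
      simp only [hK, and_true]
      rw [← this, Finset.card_filter]
    · simp [hK]
  rw [Finset.sum_congr rfl h2, Finset.sum_comm] at h1
  refine h1.trans ?_
  rw [Finset.card_filter]
  refine Finset.sum_le_sum fun m hm => ?_
  rw [gc_memA] at hm
  rw [← Finset.card_filter]
  split_ifs with hex
  · rw [Finset.card_le_one]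
    intro t ht t' ht'
    simp only [Finset.mem_filter] at ht ht'
    by_contra hne
    have e1 := gc_msize_add g (m - Finsupp.single t 1) t 1
    rw [gc_sub_add _ _ _ _ ht.2.1] at e1
    have e2 := gc_supp g (m - Finsupp.single t 1) t' (by
      rw [Finsupp.tsub_apply, Finsupp.single_eq_of_ne (Ne.symm hne)]; exact ht'.2.1)
    omega
  · rw [Nat.le_zero, Finset.card_eq_zero, Finset.filter_eq_empty_iff]
    intro t _ hc
    exact hex ⟨t, hc⟩

lemma gc_asymp (d : ℕ) (g : ℕ → ℕ) (ρ : ℝ) (hg0 : g 0 = 0) (hρ1 : ρ < 1)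
    (hsub : SubexpClass d (fun k => (g k : ℝ)) ρ) :
    (∀ᶠ m in atTop, (0:ℝ) < g (d * m) * ρ ^ (d * m)) ∧
    (∀ j, Tendsto (fun m => ((g (d * (m - j)) : ℝ) * ρ ^ (d * (m - j))) / (g (d * m) * ρ ^ (d * m))) atTop (𝓝 1)) ∧
    HasSum (fun m => (gca g (d * m) : ℝ) * ρ ^ (d * m)) (∏' t : MTy g, (1 - ρ ^ t.1))⁻¹ ∧
    Tendsto (fun m => ((gca g (d * m) : ℝ) * ρ ^ (d * m)) / (g (d * m) * ρ ^ (d * m))) atTop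
      (𝓝 (∏' t : MTy g, (1 - ρ ^ t.1))⁻¹) := by
  classical
  obtain ⟨hd1, hρ, -, hdz, ⟨N, hN⟩, hsum, -, hrat, hconv⟩ := hsub
  have hdz' : ∀ n, ¬ d ∣ n → g n = 0 := fun n hn => by
    have h : (g n : ℝ) = 0 := hdz n hn
    exact_mod_cast h
  have hinj : Function.Injective (fun m : ℕ => d * m) := fun a b h => Nat.eq_of_mul_eq_mul_left (by omega) h
  obtain ⟨hP, hF⟩ := gc_boltz g ρ hg0 hρ hρ1 hsum
  set P := ∏' t : MTy g, (1 - ρ ^ t.1)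
  set U : ℕ → ℝ := fun m => (gca g (d * m) : ℝ) * ρ ^ (d * m) with hU
  set V : ℕ → ℝ := fun m => (g (d * m) : ℝ) * ρ ^ (d * m) with hV
  have hUsum : HasSum U P⁻¹ := by
    have h1 := gc_fiber g hg0 (fun k => ρ ^ k) _ hF
    have := (hinj.hasSum_iff (f := fun k => (gca g k : ℝ) * ρ ^ k) (a := P⁻¹) ?_).2 h1
    · exact this
    · intro x hx
      have : ¬ d ∣ x := fun ⟨i, hi⟩ => hx ⟨i, hi.symm⟩
      simp [gc_dvd g d hdz' x this]
  have hz : ∀ x, x ∉ Set.range (fun m : ℕ => d * m) → (g x : ℝ) * ρ ^ x = 0 := by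
    intro x hx
    have : ¬ d ∣ x := fun ⟨i, hi⟩ => hx ⟨i, hi.symm⟩
    simp [hdz' x this]
  have hVsum : HasSum V (∑' n, (g n : ℝ) * ρ ^ n) :=
    (hinj.hasSum_iff (f := fun k => (g k : ℝ) * ρ ^ k) hz).2 hsum.hasSum
  have hVt : ∑' n, V n = ∑' n, (g n : ℝ) * ρ ^ n := hVsum.tsum_eq
  have hV0 : ∀ n, 0 ≤ V n := fun n => by positivity
  have hU0 : ∀ n, 0 ≤ U n := fun n => by positivity
  have hVpos : ∀ᶠ m in atTop, 0 < V m := by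
    filter_upwards [eventually_ge_atTop N] with m hm
    have := hN (d * m) (by nlinarith) ⟨m, rfl⟩
    exact mul_pos this (by positivity)
  have hVr : Tendsto (fun n => V n / V (n+1)) atTop (𝓝 1) := by
    have h1 := hrat.div_const (ρ ^ d)
    rw [div_self (by positivity)] at h1
    refine h1.congr fun m => ?_
    simp only [hV, mul_add, mul_one, pow_add]
    field_simp
  have hVc : Tendsto (fun n => (∑ i ∈ Finset.range (n+1), V i * V (n-i)) / V n) atTop
      (𝓝 (2 * ∑' n, V n)) := by
    rw [hVt]
    refine hconv.congr fun m => ?_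
    rw [gc_sum_mult d hd1 (fun l => (g l : ℝ) * g (d * m - l)) (fun l hl => by simp [hdz' l hl])]
    have : ∑ i ∈ Finset.range (m+1), V i * V (m-i) =
        (∑ i ∈ Finset.range (m+1), (g (d * i) : ℝ) * g (d * m - d * i)) * ρ ^ (d * m) := by
      rw [Finset.sum_mul]
      refine Finset.sum_congr rfl fun i hi => ?_
      have := Finset.mem_range.1 hi
      simp only [hV]
      rw [← Nat.mul_sub]
      have e : d * m = d * i + d * (m - i) := by rw [← mul_add]; congr 1; omega
      rw [e, pow_add]; ring
    rw [this]
    simp only [hV]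
    rw [mul_div_mul_right _ _ (by positivity)]
  have hsh := gc_shift V hVpos hVr
  refine ⟨hVpos, hsh, hUsum, ?_⟩
  -- B
  set B : ℕ → ℝ := fun m => (gcc g (d * m) : ℝ) * ρ ^ (d * m) / m / d with hB
  have hB0 : ∀ n, 0 ≤ B n := fun n => by positivity
  set σ := √ρ with hσ
  have hσ0 : 0 < σ := Real.sqrt_pos.2 hρ
  have hσ2 : σ ^ 2 = ρ := Real.sq_sqrt hρ.le
  have hσ1 : σ < 1 := by nlinarith
  set G := ∑' n, (g n : ℝ) * ρ ^ n with hG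
  have hBe : ∀ m, 1 ≤ m → V m ≤ B m ∧ B m ≤ V m + G * (σ ^ d) ^ m := by
    intro m hm
    have hl : 0 < d * m := Nat.mul_pos (by omega) (by omega)
    have hlR : (0:ℝ) < (d * m : ℕ) := by exact_mod_cast hl
    have hB' : B m = (gcc g (d * m) : ℝ) * ρ ^ (d * m) / (d * m : ℕ) := by
      simp only [hB]; rw [div_div, mul_comm (m:ℝ) d]; push_cast; rfl
    have hpw : (σ ^ d) ^ m = σ ^ (d * m) := by rw [pow_mul]
    rw [hB', hpw]
    simp only [hV]
    generalize d * m = l at hl hlR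
    have hc : (gcc g l : ℝ) = ∑ k ∈ l.properDivisors, (k:ℝ) * g k + l * g l := by
      unfold gcc
      rw [← Nat.insert_self_properDivisors hl.ne', Finset.sum_insert (by simp), add_comm]
      push_cast; rfl
    have hb : (∑ k ∈ l.properDivisors, (k:ℝ) * g k) * ρ ^ l ≤ l * (G * σ ^ l) := by
      rw [Finset.sum_mul]
      calc ∑ k ∈ l.properDivisors, (k:ℝ) * g k * ρ ^ l 
          ≤ ∑ k ∈ l.properDivisors, (l * σ ^ l) * ((g k : ℝ) * ρ ^ k) := by
            refine Finset.sum_le_sum fun k hk => ?_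
            obtain ⟨⟨c, hc⟩, hlt⟩ := Nat.mem_properDivisors.1 hk
            have hc2 : 2 ≤ c := by
              by_contra hcc
              have : c = 0 ∨ c = 1 := by omega
              rcases this with rfl | rfl <;> omega
            have hk2 : 2 * k ≤ l := by nlinarith
            have e1 : ρ ^ l = ρ ^ k * σ ^ (2 * (l - k)) := by
              rw [pow_mul, hσ2, ← pow_add]; congr 1; omega
            have e2 : σ ^ (2 * (l - k)) ≤ σ ^ l := pow_le_pow_of_le_one hσ0.le hσ1.le (by omega)
            have e3 : (k:ℝ) ≤ l := by exact_mod_cast hlt.le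
            rw [e1]
            calc (k:ℝ) * g k * (ρ ^ k * σ ^ (2 * (l - k))) = (k * σ ^ (2 * (l - k))) * ((g k : ℝ) * ρ ^ k) := by ring
              _ ≤ _ := by gcongr
        _ = (l * σ ^ l) * ∑ k ∈ l.properDivisors, ((g k : ℝ) * ρ ^ k) := by rw [Finset.mul_sum]
        _ ≤ (l * σ ^ l) * G := by
            gcongr
            exact hsum.sum_le_tsum _ fun i _ => by positivity
        _ = _ := by ring
    have hb0 : 0 ≤ (∑ k ∈ l.properDivisors, (k:ℝ) * g k) * ρ ^ l := by positivity
    rw [hc, add_mul, le_div_iff₀ hlR, div_le_iff₀ hlR]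
    constructor <;> nlinarith
  have hτ : Tendsto (fun m => (σ ^ d) ^ m / V m) atTop (𝓝 0) := by
    have hτ1 : σ ^ d < 1 := pow_lt_one₀ hσ0.le hσ1 (by omega)
    refine (summable_of_ratio_test_tendsto_lt_one hτ1 ?_ ?_).tendsto_atTop_zero
    · filter_upwards [hVpos] with m hm
      positivity
    · have h1 := hVr.mul_const (σ ^ d)
      rw [one_mul] at h1
      refine h1.congr' ?_
      filter_upwards [hVpos, (tendsto_add_atTop_nat 1).eventually hVpos] with m hm hm2
      rw [Real.norm_of_nonneg (by positivity), Real.norm_of_nonneg (by positivity), pow_succ]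
      field_simp
  have hBV : Tendsto (fun n => B n / V n) atTop (𝓝 1) := by
    have hup : Tendsto (fun m => 1 + G * ((σ ^ d) ^ m / V m)) atTop (𝓝 1) := by
      simpa using (hτ.const_mul G).const_add 1
    refine tendsto_of_tendsto_of_tendsto_of_le_of_le' tendsto_const_nhds hup ?_ ?_
    · filter_upwards [hVpos, eventually_ge_atTop 1] with m hm hm1
      rw [le_div_iff₀ hm, one_mul]
      exact (hBe m hm1).1
    · filter_upwards [hVpos, eventually_ge_atTop 1] with m hm hm1
      rw [div_le_iff₀ hm]
      refine (hBe m hm1).2.trans (le_of_eq ?_)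
      field_simp
  have hrec : ∀ n : ℕ, (n:ℝ) * U n = ∑ i ∈ Finset.range (n+1), (i:ℝ) * B i * U (n-i) := by
    intro m
    have h1 : ((d * m : ℕ) : ℝ) * gca g (d * m) = ∑ l ∈ Finset.range (d * m+1), (gcc g l : ℝ) * gca g (d * m - l) := by
      exact_mod_cast gc_rec g hg0 (d * m)
    rw [gc_sum_mult d hd1 (fun l => (gcc g l : ℝ) * gca g (d * m - l)) ?_] at h1
    · have hdR : (0:ℝ) < d := by exact_mod_cast (by omega : 0 < d)
      have h2 : (m:ℝ) * U m = (((d * m : ℕ) : ℝ) * gca g (d * m)) * ρ ^ (d * m) / d := by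
        simp only [hU]; push_cast; field_simp
      rw [h2, h1, Finset.sum_mul, Finset.sum_div]
      refine Finset.sum_congr rfl fun i hi => ?_
      have := Finset.mem_range.1 hi
      simp only [hU, hB]
      rw [← Nat.mul_sub]
      have e : d * m = d * i + d * (m - i) := by rw [← mul_add]; congr 1; omega
      rw [e, pow_add]
      rcases Nat.eq_zero_or_pos i with rfl | hi0
      · simp [gcc]
      · have : (0:ℝ) < i := by exact_mod_cast hi0
        field_simp
    · intro l hl
      have : gcc g l = 0 := by
        refine Finset.sum_eq_zero fun k hk => ?_
        rw [hdz' k (fun h => hl (h.trans (Nat.dvd_of_mem_divisors hk))), mul_zero]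
      simp [this]
  have hupper := gc_upper U V B hV0 hVpos hVsum.summable hVr hVc hB0 hBV hU0 hUsum.summable hrec
  rw [hUsum.tsum_eq] at hupper
  have hlow : ∀ K m, 2 * K < m → ∑ j ∈ Finset.range (K+1), V (m-j) * U j ≤ U m := by
    intro K m hKm
    have h1 := (gc_good g hg0 (d * m) (d * K) (by nlinarith)).trans (Finset.card_filter_le _ _)
    rw [gc_cardA] at h1
    have h2 : ∑ k ∈ Finset.range (d*K+1), (g (d*m-k) : ℝ) * gca g k ≤ gca g (d * m) := by exact_mod_cast h1
    rw [gc_sum_mult d hd1 (fun k => (g (d*m-k) : ℝ) * gca g k) (fun l hl => by simp [gc_dvd g d hdz' l hl])] at h2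
    have h3 := mul_le_mul_of_nonneg_right h2 (show 0 ≤ ρ ^ (d * m) by positivity)
    refine le_trans (le_of_eq ?_) h3
    rw [Finset.sum_mul]
    refine Finset.sum_congr rfl fun i hi => ?_
    have := Finset.mem_range.1 hi
    simp only [hU, hV]
    rw [← Nat.mul_sub]
    have e : d * m = d * i + d * (m - i) := by rw [← mul_add]; congr 1; omega
    rw [e, pow_add]; ring
  rw [tendsto_order]
  constructor
  · intro a ha
    obtain ⟨K, hK⟩ := ((hUsum.tendsto_sum_nat.comp (tendsto_add_atTop_nat 1)).eventually (lt_mem_nhds ha)).exists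
    have T : Tendsto (fun m => ∑ j ∈ Finset.range (K+1), (V (m-j) / V m) * U j) atTop
      (𝓝 (∑ j ∈ Finset.range (K+1), 1 * U j)) := tendsto_finsetSum _ fun j _ => (hsh j).mul_const _
    simp only [one_mul] at T
    filter_upwards [T.eventually (lt_mem_nhds hK), eventually_gt_atTop (2*K), hVpos] with m h1 h2 h3
    refine lt_of_lt_of_le h1 ?_
    have h4 := hlow K m h2
    rw [le_div_iff₀ h3]
    refine le_trans (le_of_eq ?_) h4
    rw [Finset.sum_mul]
    refine Finset.sum_congr rfl fun j _ => ?_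
    field_simp
  · intro a ha
    filter_upwards [hupper ((a - P⁻¹)/2) (by linarith), hVpos] with m h1 h3
    rw [div_lt_iff₀ h3]
    refine lt_of_le_of_lt h1 ?_
    refine mul_lt_mul_of_pos_right ?_ h3
    linarith

lemma gc_dTV {S : Type*} (p q : S → ℝ) (A Gd : Finset S) (ε : ℝ) (hGA : Gd ⊆ A)
    (hp0 : ∀ x, 0 ≤ p x) (hq0 : ∀ x, 0 ≤ q x) (hp : HasSum p 1) (hqs : Summable q) (hq : ∑' x, q x ≤ 1)
    (hA : ∀ x, x ∉ A → p x = 0) (hε : 0 ≤ ε) (hgood : ∀ x ∈ Gd, (1 - ε) * p x ≤ q x)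
    (hbad : (1 - ε) ≤ ∑ x ∈ Gd, p x) : 0 ≤ dTV p q ∧ dTV p q ≤ 2 * ε := by
  classical
  have key : ∀ E : Set S, ∑' x : E, p x ≤ ∑' x : E, q x + 2 * ε := by
    intro E
    set b : S → ℝ := fun x => if x ∈ A \ Gd then p x else 0 with hb
    have hb0 : ∀ x, 0 ≤ b x := fun x => by simp only [hb]; split_ifs; exacts [hp0 x, le_rfl]
    have hbs : HasSum b (∑ x ∈ A \ Gd, p x) := by
      have h := hasSum_sum_of_ne_finset_zero (L := SummationFilter.unconditional S) (f := b) (s := A \ Gd) (fun x hx => by simp only [hb]; rw [if_neg hx])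
      have e : ∑ x ∈ A \ Gd, b x = ∑ x ∈ A \ Gd, p x := Finset.sum_congr rfl fun x hx => by simp only [hb]; rw [if_pos hx]
      rwa [e] at h
    have hpA : ∑ x ∈ A, p x = 1 :=
      HasSum.unique (L := SummationFilter.unconditional S) (hasSum_sum_of_ne_finset_zero hA) hp
    have hsd := Finset.sum_sdiff (f := p) hGA
    have hle : ∀ x, p x ≤ q x + (ε * p x + b x) := by
      intro x
      by_cases hx : x ∈ Gd
      · have := hgood x hx
        have := hb0 x
        linarith
      · have h1 := hq0 x
        have h2 := mul_nonneg hε (hp0 x)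
        by_cases hxA : x ∈ A
        · have : b x = p x := by simp only [hb]; rw [if_pos (Finset.mem_sdiff.2 ⟨hxA, hx⟩)]
          linarith
        · have := hA x hxA
          have := hb0 x
          linarith
    have hsm : Summable fun x => ε * p x + b x := (hp.summable.mul_left ε).add hbs.summable
    have h1 : ∑' x : E, p x ≤ ∑' x : E, (q x + (ε * p x + b x)) :=
      (hp.summable.subtype E).tsum_le_tsum (fun x => hle x) ((hqs.add hsm).subtype E)
    have h1' : ∑' x : E, (q x + (ε * p x + b x)) = ∑' x : E, q x + ∑' x : E, (ε * p x + b x) :=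
      (hqs.subtype E).tsum_add (hsm.subtype E)
    have h2 : ∑' x : E, (ε * p x + b x) ≤ ∑' x, (ε * p x + b x) :=
      Summable.tsum_subtype_le (fun x => ε * p x + b x) E (fun x => add_nonneg (mul_nonneg hε (hp0 x)) (hb0 x)) hsm
    have h3 : ∑' x, (ε * p x + b x) = ε * 1 + ∑ x ∈ A \ Gd, p x := ((hp.mul_left ε).add hbs).tsum_eq
    linarith
  have key2 : ∀ E : Set S, |(∑' x : E, p x) - ∑' x : E, q x| ≤ 2 * ε := by
    intro E
    rw [abs_le]
    have h1 := key E
    have h2 := key Eᶜ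
    have h3 := hp.summable.tsum_subtype_add_tsum_subtype_compl E
    have h4 := hqs.tsum_subtype_add_tsum_subtype_compl E
    rw [hp.tsum_eq] at h3
    constructor <;> linarith
  exact ⟨Real.iSup_nonneg fun E => abs_nonneg _, ciSup_le key2⟩

lemma gc_hat_some (g : ℕ → ℕ) (ρ : ℝ) (n : ℕ) (m : MTy g →₀ ℕ) (hm : msize g m = n) :
    pHat g ρ n (some m) = ∑ t ∈ gcT g n,
      if 1 ≤ m t then (∏' t : MTy g, (1 - ρ ^ t.1)) * ρ ^ (n - t.1) / (g t.1 : ℝ) else 0 := by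
  simp only [pHat]
  rw [if_pos hm, tsum_eq_sum (s := gcT g n)]
  · refine Finset.sum_congr rfl fun t _ => ?_
    split_ifs with h
    · have e1 := gc_msize_add g (m - Finsupp.single t 1) t 1
      rw [gc_sub_add _ _ _ _ h] at e1
      have e2 : msize g (m - Finsupp.single t 1) = n - t.1 := by omega
      rw [pBoltz, e2]
    · rfl
  · intro t ht
    rw [gc_memT] at ht
    rw [if_neg]
    intro h
    have := gc_supp g m t h
    omega

lemma gc_hat_nonneg (g : ℕ → ℕ) (ρ : ℝ) (hρ : 0 < ρ) (hP : 0 < ∏' t : MTy g, (1 - ρ ^ t.1)) (n : ℕ)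
    (x : Option (MTy g →₀ ℕ)) : 0 ≤ pHat g ρ n x := by
  have hb : ∀ r, 0 ≤ pBoltz g ρ r := fun r => by unfold pBoltz; positivity
  cases x with
  | none =>
    simp only [pHat]
    refine tsum_nonneg fun r => ?_
    split_ifs
    exacts [hb r, le_rfl]
  | some m =>
    simp only [pHat]
    split_ifs
    · refine tsum_nonneg fun t => ?_
      split_ifs
      · exact div_nonneg (hb _) (by positivity)
      · exact le_rfl
    · exact le_rfl

lemma gc_hat_mass (g : ℕ → ℕ) (hg0 : g 0 = 0) (ρ : ℝ) (hρ : 0 < ρ) (hP : 0 < ∏' t : MTy g, (1 - ρ ^ t.1))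
    (hF : HasSum (fun m : MTy g →₀ ℕ => ρ ^ msize g m) (∏' t : MTy g, (1 - ρ ^ t.1))⁻¹) (n : ℕ) :
    HasSum (pHat g ρ n) 1 := by
  classical
  have hz : ∀ x, x ∉ (gcA g hg0 n).insertNone → pHat g ρ n x = 0 := by
    intro x hx
    cases x with
    | none => simp at hx
    | some m =>
      simp only [Finset.some_mem_insertNone, gc_memA] at hx
      simp only [pHat]
      rw [if_neg hx]
  have h := hasSum_sum_of_ne_finset_zero (L := SummationFilter.unconditional _) hz
  suffices hs : ∑ x ∈ (gcA g hg0 n).insertNone, pHat g ρ n x = 1 by rwa [hs] at h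
  rw [Finset.sum_insertNone]
  set P := ∏' t : MTy g, (1 - ρ ^ t.1) with hPdef
  -- total mass
  have hu := gc_fiber g hg0 (fun k => P * ρ ^ k) 1 (by
    have := hF.mul_left P
    rwa [mul_inv_cancel₀ hP.ne'] at this)
  set bad : ℕ → Prop := fun k => n ≤ k ∨ g (n - k) = 0 with hbad
  have hnone : pHat g ρ n none = ∑' k, (gca g k : ℝ) * (if bad k then P * ρ ^ k else 0) := by
    have hsm : Summable (fun m : MTy g →₀ ℕ => if bad (msize g m) then P * ρ ^ (msize g m) else 0) := by
      refine Summable.of_nonneg_of_le (fun m => ?_) (fun m => ?_) (hF.mul_left P).summable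
      · split_ifs
        · positivity
        · exact le_rfl
      · split_ifs
        · exact le_rfl
        · positivity
    have := gc_fiber g hg0 (fun k => if bad k then P * ρ ^ k else 0) _ hsm.hasSum
    rw [this.tsum_eq]
    simp only [pHat, pBoltz, hbad, ← hPdef]
  have hsome : ∑ m ∈ gcA g hg0 n, pHat g ρ n (some m) 
      = ∑ k ∈ Finset.range (n+1), (gca g k : ℝ) * (if bad k then 0 else P * ρ ^ k) := by
    rw [Finset.sum_congr rfl (fun m hm => gc_hat_some g ρ n m ((gc_memA g hg0 n m).1 hm)), Finset.sum_comm]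
    have h3 : ∀ t ∈ gcT g n, (∑ m ∈ gcA g hg0 n, if 1 ≤ m t then P * ρ ^ (n - t.1) / (g t.1 : ℝ) else 0)
        = (gca g (n - t.1) : ℝ) * (P * ρ ^ (n - t.1) / (g t.1 : ℝ)) := by
      intro t ht
      rw [gc_memT] at ht
      have := gc_card_ge g hg0 n t 1
      rw [one_mul, if_pos ht] at this
      rw [← Finset.sum_filter, Finset.sum_const, this, nsmul_eq_mul]
    rw [Finset.sum_congr rfl h3, gc_sumT g n (fun k => (gca g (n - k) : ℝ) * (P * ρ ^ (n - k) / (g k : ℝ))),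
      ← Finset.sum_range_reflect _ (n+1)]
    refine Finset.sum_congr rfl fun k hk => ?_
    have hk' := Finset.mem_range.1 hk
    have e1 : n + 1 - 1 - k = n - k := by omega
    have e2 : n - (n - k) = k := by omega
    rw [e1, e2]
    split_ifs with hb
    · have : g (n - k) = 0 := by
        rcases hb with hb | hb
        · rw [show n - k = 0 by omega, hg0]
        · exact hb
      simp [this]
    · have : (g (n-k) : ℝ) ≠ 0 := by
        simp only [hbad, not_or] at hb
        exact_mod_cast hb.2
      field_simp
  have hsome2 : HasSum (fun k => (gca g k : ℝ) * (if bad k then 0 else P * ρ ^ k))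
      (∑ k ∈ Finset.range (n+1), (gca g k : ℝ) * (if bad k then 0 else P * ρ ^ k)) := by
    refine hasSum_sum_of_ne_finset_zero fun k hk => ?_
    have : n ≤ k := by
      by_contra h
      exact hk (Finset.mem_range.2 (by omega))
    rw [if_pos (Or.inl this), mul_zero]
  have hd := hu.sub hsome2
  have hd2 : (fun k => (gca g k : ℝ) * (P * ρ ^ k) - (gca g k : ℝ) * (if bad k then 0 else P * ρ ^ k))
      = fun k => (gca g k : ℝ) * (if bad k then P * ρ ^ k else 0) := by
    funext k
    split_ifs <;> ring
  rw [hd2] at hd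
  rw [hnone, hsome, hd.tsum_eq]
  ring

/-- If the generating series of the non-negative integers `(g_k)_{k ≥ 1}` (supported on
multiples of `d`) belongs to `𝒮_d` with radius of convergence `ρ ∈ (0,1)`, then the uniformly
random multiset `S_n` of total size `n` and the two-step sample `Ŝ_n` (Boltzmann remainder
plus one element of a uniformly random type of the complementary size, with a placeholder `⋄`
in the degenerate case) satisfy `d_TV(S_n, Ŝ_n) → 0` along multiples of `d`. -/
theorem giant_component_total_variation_approximation
    (d : ℕ) (g : ℕ → ℕ) (ρ : ℝ) (hg0 : g 0 = 0) (hρ1 : ρ < 1)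
    (hsub : SubexpClass d (fun k => (g k : ℝ)) ρ) :
    Filter.Tendsto
      (fun m => dTV
        (fun o : Option (MTy g →₀ ℕ) => o.elim 0 (pUnif g (d * m)))
        (pHat g ρ (d * m)))
      Filter.atTop (nhds 0) := by
  classical
  have hsub' := hsub
  obtain ⟨hd1, hρ, -, hdz, -, hsum, -, -, -⟩ := hsub'
  have hdz' : ∀ n, ¬ d ∣ n → g n = 0 := fun n hn => by
    have h : (g n : ℝ) = 0 := hdz n hn
    exact_mod_cast h
  obtain ⟨hP, hF⟩ := gc_boltz g ρ hg0 hρ hρ1 hsum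
  obtain ⟨hVpos, hsh, hUsum, hUV⟩ := gc_asymp d g ρ hg0 hρ1 hsub
  have hmass := gc_hat_mass g hg0 ρ hρ hP hF
  have hnn := gc_hat_nonneg g ρ hρ hP
  have hhat := gc_hat_some g ρ
  set P := ∏' t : MTy g, (1 - ρ ^ t.1) with hPdef
  have hPi : 0 < P⁻¹ := inv_pos.2 hP
  have main : ∀ ε : ℝ, 0 < ε → ε < 1 → ∀ᶠ m in Filter.atTop, 
      0 ≤ dTV (fun o : Option (MTy g →₀ ℕ) => o.elim 0 (pUnif g (d * m))) (pHat g ρ (d * m)) ∧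
      dTV (fun o : Option (MTy g →₀ ℕ) => o.elim 0 (pUnif g (d * m))) (pHat g ρ (d * m)) ≤ 2 * ε := by
    intro ε hε hε1
    have hlt : (1 - ε) * P⁻¹ < P⁻¹ := by nlinarith
    obtain ⟨K, hK⟩ := ((hUsum.tendsto_sum_nat.comp (tendsto_add_atTop_nat 1)).eventually (lt_mem_nhds hlt)).exists
    simp only [Function.comp] at hK
    have C0 := hUV.eventually (lt_mem_nhds hPi)
    have C1 : ∀ᶠ m in atTop, ∀ j ∈ Finset.range (K+1),
        (1 - ε) * (((g (d * (m - j)) : ℝ) * ρ ^ (d * (m - j))) / (g (d * m) * ρ ^ (d * m)))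
          < P * (((gca g (d * m) : ℝ) * ρ ^ (d * m)) / (g (d * m) * ρ ^ (d * m))) := by
      rw [Finset.eventually_all]
      intro j _
      refine ((hsh j).const_mul (1 - ε)).eventually_lt (hUV.const_mul P) ?_
      rw [mul_inv_cancel₀ hP.ne']; linarith
    have T : Tendsto (fun m => ∑ j ∈ Finset.range (K+1),
        (((g (d * (m - j)) : ℝ) * ρ ^ (d * (m - j))) / (g (d * m) * ρ ^ (d * m))) * ((gca g (d * j) : ℝ) * ρ ^ (d * j)))
        atTop (𝓝 (∑ j ∈ Finset.range (K+1), 1 * ((gca g (d * j) : ℝ) * ρ ^ (d * j)))) :=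
      tendsto_finsetSum _ fun j _ => (hsh j).mul_const _
    simp only [one_mul] at T
    have C2 := (hUV.const_mul (1 - ε)).eventually_lt T hK
    filter_upwards [hVpos, C0, C1, C2, eventually_gt_atTop (2 * K)] with m hV h0 h1 h2 hmK
    set n := d * m with hn
    have hU : 0 < (gca g n : ℝ) * ρ ^ n := by
      have := mul_pos h0 hV
      rwa [div_mul_cancel₀ _ hV.ne'] at this
    have ha : 0 < (gca g n : ℝ) := pos_of_mul_pos_left hU (by positivity)
    have h1' : ∀ j ∈ Finset.range (K+1), (1 - ε) * ((g (d * (m - j)) : ℝ) * ρ ^ (d * (m - j)))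
        ≤ P * ((gca g n : ℝ) * ρ ^ n) := by
      intro j hj
      have := h1 j hj
      rw [← mul_div_assoc, ← mul_div_assoc, div_lt_div_iff_of_pos_right hV] at this
      exact this.le
    have h2' : (1 - ε) * (gca g n : ℝ) ≤ ∑ j ∈ Finset.range (K+1), (g (d * (m - j)) : ℝ) * gca g (d * j) := by
      have e : ∑ j ∈ Finset.range (K+1),
        (((g (d * (m - j)) : ℝ) * ρ ^ (d * (m - j))) / (g n * ρ ^ n)) * ((gca g (d * j) : ℝ) * ρ ^ (d * j))
        = (∑ j ∈ Finset.range (K+1), (g (d * (m - j)) : ℝ) * gca g (d * j)) * ρ ^ n / (g n * ρ ^ n) := by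
        rw [Finset.sum_mul, Finset.sum_div]
        refine Finset.sum_congr rfl fun j hj => ?_
        have := Finset.mem_range.1 hj
        have e : n = d * j + d * (m - j) := by rw [hn, ← mul_add]; congr 1; omega
        have e' : ρ ^ n = ρ ^ (d * j) * ρ ^ (d * (m - j)) := by rw [e, pow_add]
        rw [div_mul_eq_mul_div]
        congr 1
        rw [e']; ring
      rw [e, ← mul_div_assoc, div_lt_div_iff_of_pos_right hV, ← mul_assoc] at h2
      exact (lt_of_mul_lt_mul_right h2 (by positivity)).le
    have hgd := gc_good g hg0 n (d * K) (by rw [hn]; nlinarith)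
    set Gd := (gcA g hg0 n).filter fun m => ∃ t, 1 ≤ m t ∧ n ≤ t.1 + d * K with hGd
    have hgd' : (1 - ε) * (gca g n : ℝ) ≤ Gd.card := by
      have h3 : ∑ k ∈ Finset.range (d*K+1), (g (n-k) : ℝ) * gca g k ≤ Gd.card := by exact_mod_cast hgd
      rw [gc_sum_mult d hd1 (fun k => (g (n-k) : ℝ) * gca g k) (fun l hl => by simp [gc_dvd g d hdz' l hl])] at h3
      refine h2'.trans (le_trans (le_of_eq ?_) h3)
      refine Finset.sum_congr rfl fun j _ => ?_
      rw [hn, Nat.mul_sub]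
    have hpu : ∀ r ∈ gcA g hg0 n, pUnif g n r = (gca g n : ℝ)⁻¹ := by
      intro r hr
      rw [gc_memA] at hr
      rw [pUnif, if_pos hr]; rfl
    have hpz : ∀ x : Option (MTy g →₀ ℕ), x ∉ (gcA g hg0 n).map Function.Embedding.some → 
        x.elim 0 (pUnif g n) = 0 := by
      intro x hx
      cases x with
      | none => rfl
      | some r =>
        have : ¬ msize g r = n := by
          intro h
          exact hx (Finset.mem_map.2 ⟨r, (gc_memA g hg0 n r).2 h, rfl⟩)
        simp [pUnif, this]
    refine gc_dTV _ _ ((gcA g hg0 n).map Function.Embedding.some) (Gd.map Function.Embedding.some) ε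
      (Finset.map_subset_map.2 (Finset.filter_subset _ _)) ?_ (hnn n) ?_ (hmass n).summable (hmass n).tsum_eq.le
      hpz hε.le ?_ ?_
    · intro x
      cases x with
      | none => exact le_rfl
      | some r =>
        simp only [Option.elim, pUnif]
        split_ifs
        · positivity
        · exact le_rfl
    · have h := hasSum_sum_of_ne_finset_zero (L := SummationFilter.unconditional _) hpz
      have e : ∑ x ∈ (gcA g hg0 n).map Function.Embedding.some, x.elim 0 (pUnif g n) = 1 := by
        rw [Finset.sum_map]
        simp only [Function.Embedding.some_apply, Option.elim]
        rw [Finset.sum_congr rfl hpu, Finset.sum_const, gc_cardA, nsmul_eq_mul, mul_inv_cancel₀ ha.ne']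
      rwa [e] at h
    · intro x hx
      obtain ⟨r, hr, rfl⟩ := Finset.mem_map.1 hx
      obtain ⟨hrA, t, ht, htK⟩ := Finset.mem_filter.1 hr
      simp only [Function.Embedding.some_apply, Option.elim]
      rw [hpu r hrA]
      have hrn := (gc_memA g hg0 n r).1 hrA
      have htn : t.1 ≤ n := by rw [← hrn]; exact gc_supp g r t ht
      rw [hhat n r hrn]
      have hgt : 0 < g t.1 := by have := t.2.2; omega
      have hgR : (0:ℝ) < g t.1 := by exact_mod_cast hgt
      have hdt : d ∣ t.1 := by
        by_contra h
        have := hdz' _ h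
        omega
      refine le_trans ?_ (Finset.single_le_sum (f := fun t : MTy g => if 1 ≤ r t then P * ρ ^ (n - t.1) / (g t.1 : ℝ) else 0)
        (fun t _ => ?_) ((gc_memT g n t).2 htn))
      · beta_reduce
        rw [if_pos ht]
        obtain ⟨i, hi⟩ := hdt
        have him : i ≤ m := Nat.le_of_mul_le_mul_left (by rw [← hi]; exact htn) (show 0 < d by omega)
        have hiK : m ≤ i + K := by
          refine Nat.le_of_mul_le_mul_left (c := d) ?_ (by omega)
          rw [mul_add, ← hi]; exact htK
        have h3 := h1' (m - i) (Finset.mem_range.2 (by omega))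
        rw [Nat.sub_sub_self him, ← hi] at h3
        have e' : ρ ^ n = ρ ^ (n - t.1) * ρ ^ t.1 := by rw [← pow_add]; congr 1; omega
        rw [e'] at h3
        have h4 : (1 - ε) * (g t.1 : ℝ) ≤ P * (gca g n * ρ ^ (n - t.1)) := by
          refine le_of_mul_le_mul_right (a := ρ ^ t.1) ?_ (by positivity)
          linarith
        rw [← div_eq_mul_inv, div_le_div_iff₀ ha hgR]
        linarith
      · beta_reduce
        split_ifs
        · positivity
        · exact le_rfl
    · rw [Finset.sum_map]
      simp only [Function.Embedding.some_apply, Option.elim]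
      rw [Finset.sum_congr rfl (fun r hr => hpu r (Finset.mem_filter.1 hr).1), Finset.sum_const, nsmul_eq_mul,
        ← div_eq_mul_inv, le_div_iff₀ ha]
      exact hgd'
  rw [Metric.tendsto_nhds]
  intro δ hδ
  have hmin : 0 < min (δ/4) (1/2) := lt_min (by linarith) (by norm_num)
  filter_upwards [main (min (δ/4) (1/2)) hmin (lt_of_le_of_lt (min_le_right _ _) (by norm_num))] with m hm
  rw [Real.dist_eq, sub_zero, abs_of_nonneg hm.1]
  have := min_le_left (δ/4) (1/2)
  linarith [hm.2]
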